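/- For all a, b, a', b', c in the finite field F = GF(3^5), the map ψ_{a,b} of F^4 sending (u, t, r, s) to (u, t + h_{(a,b)}(r,s) − g_{(a,b)}(u), r − u·a, s − u·b) maps the set F(a',b',c) = { (u, u·c + h_{(a',b')}(r,s), r, s) : u in the prime subfield GF(3) of F, r, s ∈ F } onto the set F(a+a', b+b', c'), where c' = c − g_{(a,b)}(1) + h_{(a+a',b+b')}(a,b); that is, the image of F(a',b',c) under ψ_{a,b} equals { (u, u·c' + h_{(a+a',b+b')}(r,s), r, s) : u in the prime subfield GF(3) of F, r, s ∈ F }. (The collineation ψ_{a,b} permutes the family F_E of affine subspaces through the elements I(a,b).) -/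

import Mathlib

/-- `F = GF(3^5)`, the finite field with `3^5 = 243` elements. -/
abbrev F : Type := GaloisField 3 5

/-- `g_{(a,b)}(t) = a^2*t - (b^2)^9*t^9 + (a*b)^81*t^81`. -/
noncomputable def g (a b t : F) : F :=
  a ^ 2 * t - (b ^ 2) ^ 9 * t ^ 9 + (a * b) ^ 81 * t ^ 81

/-- `h_{(a,b)}(r,s) = -a*r + b^9*s^9 + (b*r + a*s)^81`. -/
noncomputable def h (a b r s : F) : F :=
  -a * r + b ^ 9 * s ^ 9 + (b * r + a * s) ^ 81

/-- The collineation `ψ_{a,b} : (u,t,r,s) ↦ (u, t + h_{(a,b)}(r,s) - g_{(a,b)}(u),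
r - u*a, s - u*b)`. -/
noncomputable def psi (a b : F) (p : F × F × F × F) : F × F × F × F :=
  (p.1, p.2.1 + h a b p.2.2.1 p.2.2.2 - g a b p.1,
    p.2.2.1 - p.1 * a, p.2.2.2 - p.1 * b)

theorem pow_nine_of_pow_three {u : F} (hu : u ^ 3 = u) : u ^ 9 = u := by
  rw [show u ^ 9 = (u ^ 3) ^ 3 by ring, hu, hu]

theorem pow_eighty_one_of_pow_three {u : F} (hu : u ^ 3 = u) : u ^ 81 = u := by
  rw [show u ^ 81 = (u ^ 9) ^ 9 by ring, pow_nine_of_pow_three hu, pow_nine_of_pow_three hu]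

theorem add_pow_nine (x y : F) : (x + y) ^ 9 = x ^ 9 + y ^ 9 :=
  add_pow_char_pow (p := 3) (n := 2) x y

theorem add_pow_eighty_one (x y : F) : (x + y) ^ 81 = x ^ 81 + y ^ 81 :=
  add_pow_char_pow (p := 3) (n := 4) x y

/-- `g_{(a,b)}` is linear over the prime subfield. -/
theorem g_of_pow_three (a b : F) {u : F} (hu : u ^ 3 = u) : g a b u = u * g a b 1 := by
  simp only [g, pow_nine_of_pow_three hu, pow_eighty_one_of_pow_three hu, one_pow]
  ring

theorem h_add_param (a b a' b' r s : F) :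
    h (a + a') (b + b') r s = h a b r s + h a' b' r s := by
  simp only [h, add_mul, add_pow_nine, add_pow_eighty_one]
  ring

theorem h_add (a b r s r' s' : F) : h a b (r + r') (s + s') = h a b r s + h a b r' s' := by
  simp only [h, mul_add, add_pow_nine, add_pow_eighty_one]
  ring

theorem h_smul (a b r s : F) {u : F} (hu : u ^ 3 = u) :
    h a b (u * r) (u * s) = u * h a b r s := by
  have e : b * (u * r) + a * (u * s) = u * (b * r + a * s) := by ring
  simp only [h, e, mul_pow u, pow_nine_of_pow_three hu, pow_eighty_one_of_pow_three hu]
  ring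

/-- The image under `ψ_{a,b}` of a point of `F(a',b',c)`, in the coordinates of the target. -/
theorem psi_apply_family (a b a' b' c r s : F) {u : F} (hu : u ^ 3 = u) :
    psi a b (u, u * c + h a' b' (r + u * a) (s + u * b), r + u * a, s + u * b) =
      (u, u * (c - g a b 1 + h (a + a') (b + b') a b) + h (a + a') (b + b') r s, r, s) := by
  have key : h a b (r + u * a) (s + u * b) + h a' b' (r + u * a) (s + u * b) =
      h (a + a') (b + b') r s + u * h (a + a') (b + b') a b := by
    rw [← h_add_param, h_add, h_smul _ _ _ _ hu]
  simp only [psi, add_sub_cancel_right, g_of_pow_three a b hu, Prod.mk.injEq, true_and, and_true]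
  linear_combination key

/-- `ψ_{a,b}` maps the member `F(a',b',c)` of the family `F_E` (affine
`2m`-subspaces through `I(a',b')`, parametrized by `u` in the prime subfield
`GF(3) = {u : u^3 = u}`) onto `F(a+a', b+b', c')` with
`c' = c - g_{(a,b)}(1) + h_{(a+a',b+b')}(a,b)`. -/
theorem psi_maps_family (a b a' b' c : F) :
    psi a b '' {p : F × F × F × F | ∃ u r s : F, u ^ 3 = u ∧
        p = (u, u * c + h a' b' r s, r, s)} =
    {p : F × F × F × F | ∃ u r s : F, u ^ 3 = u ∧
        p = (u, u * (c - g a b 1 + h (a + a') (b + b') a b) + h (a + a') (b + b') r s,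
          r, s)} := by
  ext p
  constructor
  · rintro ⟨_, ⟨u, r, s, hu, rfl⟩, rfl⟩
    refine ⟨u, r - u * a, s - u * b, hu, ?_⟩
    simpa only [sub_add_cancel] using
      psi_apply_family a b a' b' c (r - u * a) (s - u * b) hu
  · rintro ⟨u, r, s, hu, rfl⟩
    exact ⟨_, ⟨u, r + u * a, s + u * b, hu, rfl⟩, psi_apply_family a b a' b' c r s hu⟩
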